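/- In the areal interpolation setup at target level, the composite predictor Ŷ^C_T = (λ_T/λ_S)·Y_S is unbiased, E(Ŷ^C_T − Y_T) = 0, and its mean square error satisfies E((Ŷ^C_T − Y_T)²) = λ_T − λ_T²/λ_S = Var(Ŷ^DAX_T − Y_T) − λ_S·(x_T/x_S − λ_T/λ_S)² = Var(Ŷ^DAW_T − Y_T) − λ_S·(|T|/|S| − λ_T/λ_S)²; in particular its mean square error is at most each of Var(Ŷ^DAW_T − Y_T) and Var(Ŷ^DAX_T − Y_T). -/

import Mathlib

open MeasureTheory ProbabilityTheory

open scoped NNReal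

section PoissonSeries

open scoped Nat

/-- The Poisson recursion `E[N f(N)] = r E[f(N + 1)]`, written for the weighted series. -/
lemma hasSum_poisson_weight_nat_mul (r : ℝ≥0) {f : ℕ → ℝ} {a : ℝ}
    (h : HasSum (fun n : ℕ => Real.exp (-r) * r ^ n / n ! * f (n + 1)) a) :
    HasSum (fun n : ℕ => Real.exp (-r) * r ^ n / n ! * (n * f n)) (r * a) := by
  refine (hasSum_nat_add_iff' 1).mp ?_
  convert! h.mul_left (r : ℝ) using 1
  · ext n
    have h1 : (n ! : ℝ) ≠ 0 := by positivity
    have h2 : (n : ℝ) + 1 ≠ 0 := by positivity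
    rw [Nat.factorial_succ]
    push_cast
    field_simp
    ring
  · simp

lemma hasSum_poisson_weight_nat (r : ℝ≥0) :
    HasSum (fun n : ℕ => Real.exp (-r) * r ^ n / n ! * (n : ℝ)) r := by
  simpa using hasSum_poisson_weight_nat_mul r (f := fun _ => 1) (a := 1)
    (by simpa using hasSum_one_poissonMeasure r)

lemma hasSum_poisson_weight_nat_sq (r : ℝ≥0) :
    HasSum (fun n : ℕ => Real.exp (-r) * r ^ n / n ! * (n : ℝ) ^ 2) (r * (r + 1)) := by
  simpa [pow_two] using hasSum_poisson_weight_nat_mul r (f := fun n => (n : ℝ)) (a := r + 1)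
    (by simpa [mul_add] using (hasSum_poisson_weight_nat r).add (hasSum_one_poissonMeasure r))

end PoissonSeries

lemma integral_natCast_poissonMeasure (r : ℝ≥0) : ∫ n : ℕ, (n : ℝ) ∂(poissonMeasure r) = r := by
  rw [integral_poissonMeasure]
  simpa only [smul_eq_mul] using (hasSum_poisson_weight_nat r).tsum_eq

lemma memLp_two_natCast_poissonMeasure (r : ℝ≥0) :
    MemLp (fun n : ℕ => (n : ℝ)) 2 (poissonMeasure r) := by
  rw [memLp_two_iff_integrable_sq Measurable.of_discrete.aestronglyMeasurable,
    integrable_poissonMeasure_iff]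
  simpa using (hasSum_poisson_weight_nat_sq r).summable

lemma variance_natCast_poissonMeasure (r : ℝ≥0) :
    variance (fun n : ℕ => (n : ℝ)) (poissonMeasure r) = r := by
  rw [variance_eq_sub (memLp_two_natCast_poissonMeasure r), integral_natCast_poissonMeasure]
  have h : ∫ n : ℕ, ((fun n : ℕ => (n : ℝ)) ^ 2) n ∂(poissonMeasure r) = r * (r + 1) := by
    rw [integral_poissonMeasure]
    simpa only [smul_eq_mul, Pi.pow_apply] using (hasSum_poisson_weight_nat_sq r).tsum_eq
  rw [h]
  ring

section MapEqPoisson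

variable {Ω : Type*} {mΩ : MeasurableSpace Ω} {μ : Measure Ω} {Y : Ω → ℕ} {r : ℝ≥0}

lemma memLp_two_natCast_of_map_eq_poissonMeasure (hY : Measurable Y)
    (h : μ.map Y = poissonMeasure r) : MemLp (fun ω => (Y ω : ℝ)) 2 μ :=
  (h ▸ memLp_two_natCast_poissonMeasure r : MemLp (fun n : ℕ => (n : ℝ)) 2 (μ.map Y)).comp_of_map
    hY.aemeasurable

lemma integral_natCast_of_map_eq_poissonMeasure (hY : Measurable Y)
    (h : μ.map Y = poissonMeasure r) : ∫ ω, (Y ω : ℝ) ∂μ = r := by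
  rw [← integral_natCast_poissonMeasure r, ← h,
    integral_map hY.aemeasurable Measurable.of_discrete.aestronglyMeasurable]

lemma variance_natCast_of_map_eq_poissonMeasure (hY : Measurable Y)
    (h : μ.map Y = poissonMeasure r) : variance (fun ω => (Y ω : ℝ)) μ = r := by
  rw [← variance_natCast_poissonMeasure r, ← h,
    variance_map Measurable.of_discrete.aemeasurable hY.aemeasurable]
  rfl

end MapEqPoisson

lemma ProbabilityTheory.IndepFun.variance_mul_add_sub_left {Ω : Type*} {mΩ : MeasurableSpace Ω}
    {μ : Measure Ω} {X Y : Ω → ℝ} (hX : MemLp X 2 μ) (hY : MemLp Y 2 μ)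
    (h : IndepFun X Y μ) (p : ℝ) :
    variance (fun ω => p * (X ω + Y ω) - X ω) μ
      = (p - 1) ^ 2 * variance X μ + p ^ 2 * variance Y μ := by
  have heq : (fun ω => p * (X ω + Y ω) - X ω) = fun ω => (p - 1) * X ω + p * Y ω := by
    ext ω
    ring
  have hind : IndepFun (fun ω => (p - 1) * X ω) (fun ω => p * Y ω) μ :=
    h.comp (measurable_const_mul (p - 1)) (measurable_const_mul p)
  rw [heq, hind.variance_fun_add (hX.const_mul _) (hY.const_mul _), variance_const_mul,
    variance_const_mul]

/-- The composite predictor `Ŷ^C_T = (λ_T/λ_S)·Y_S` is unbiased and its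
mean square error equals `λ_T − λ_T²/λ_S`, which equals
`Var(Ŷ^DAX_T − Y_T) − λ_S·(x_T/x_S − λ_T/λ_S)²` and
`Var(Ŷ^DAW_T − Y_T) − λ_S·(|T|/|S| − λ_T/λ_S)²`; in particular it is at most each of the
two variances. -/
theorem composite_predictor_error
    {Ω : Type*} [MeasureSpace Ω] [IsProbabilityMeasure (ℙ : Measure Ω)]
    (α β aS xS aT xT : ℝ)
    (hα : 0 ≤ α) (hβ : 0 ≤ β) (haS : 0 < aS) (hxS : 0 < xS)
    (haT0 : 0 ≤ aT) (haTS : aT ≤ aS) (hxT0 : 0 ≤ xT) (hxTS : xT ≤ xS)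
    (hlamT : 0 < α * aT + β * xT)
    (hlamST : 0 < (α * aS + β * xS) - (α * aT + β * xT))
    (YT YSc : Ω → ℕ) (hYTm : Measurable YT) (hYScm : Measurable YSc)
    (hindep : IndepFun YT YSc)
    (hYTd : Measure.map YT ℙ = poissonMeasure (α * aT + β * xT).toNNReal)
    (hYScd : Measure.map YSc ℙ
      = poissonMeasure ((α * aS + β * xS) - (α * aT + β * xT)).toNNReal) :
    (∫ ω, (((α * aT + β * xT) / (α * aS + β * xS)) * ((YT ω : ℝ) + (YSc ω : ℝ))
        - (YT ω : ℝ)) ∂ℙ = 0) ∧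
    (∫ ω, (((α * aT + β * xT) / (α * aS + β * xS)) * ((YT ω : ℝ) + (YSc ω : ℝ))
        - (YT ω : ℝ)) ^ 2 ∂ℙ
      = (α * aT + β * xT) - (α * aT + β * xT) ^ 2 / (α * aS + β * xS)) ∧
    ((α * aT + β * xT) - (α * aT + β * xT) ^ 2 / (α * aS + β * xS)
      = variance (fun ω => (xT / xS) * ((YT ω : ℝ) + (YSc ω : ℝ)) - (YT ω : ℝ)) ℙ
        - (α * aS + β * xS)
          * (xT / xS - (α * aT + β * xT) / (α * aS + β * xS)) ^ 2) ∧
    ((α * aT + β * xT) - (α * aT + β * xT) ^ 2 / (α * aS + β * xS)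
      = variance (fun ω => (aT / aS) * ((YT ω : ℝ) + (YSc ω : ℝ)) - (YT ω : ℝ)) ℙ
        - (α * aS + β * xS)
          * (aT / aS - (α * aT + β * xT) / (α * aS + β * xS)) ^ 2) ∧
    ((α * aT + β * xT) - (α * aT + β * xT) ^ 2 / (α * aS + β * xS)
      ≤ variance (fun ω => (aT / aS) * ((YT ω : ℝ) + (YSc ω : ℝ)) - (YT ω : ℝ)) ℙ) ∧
    ((α * aT + β * xT) - (α * aT + β * xT) ^ 2 / (α * aS + β * xS)
      ≤ variance (fun ω => (xT / xS) * ((YT ω : ℝ) + (YSc ω : ℝ)) - (YT ω : ℝ)) ℙ) := by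
  have hT := memLp_two_natCast_of_map_eq_poissonMeasure hYTm hYTd
  have hSc := memLp_two_natCast_of_map_eq_poissonMeasure hYScm hYScd
  have eT := integral_natCast_of_map_eq_poissonMeasure hYTm hYTd
  have eSc := integral_natCast_of_map_eq_poissonMeasure hYScm hYScd
  have vT := variance_natCast_of_map_eq_poissonMeasure hYTm hYTd
  have vSc := variance_natCast_of_map_eq_poissonMeasure hYScm hYScd
  rw [Real.coe_toNNReal _ hlamT.le] at eT vT
  rw [Real.coe_toNNReal _ hlamST.le] at eSc vSc
  have hind : IndepFun (fun ω => (YT ω : ℝ)) (fun ω => (YSc ω : ℝ)) ℙ :=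
    hindep.comp (φ := fun n : ℕ => (n : ℝ)) (ψ := fun n : ℕ => (n : ℝ)) .of_discrete .of_discrete
  have hvar := hind.variance_mul_add_sub_left hT hSc
  rw [vT, vSc] at hvar
  clear vT vSc hYTd hYScd
  generalize α * aT + β * xT = lT at *
  generalize α * aS + β * xS = lS at *
  have hS : 0 < lS := by linarith
  have hS0 : lS ≠ 0 := hS.ne'
  have hmean : ∫ ω, (lT / lS * ((YT ω : ℝ) + (YSc ω : ℝ)) - (YT ω : ℝ)) ∂ℙ = 0 := by
    have iT := hT.integrable one_le_two
    have iSc := hSc.integrable one_le_two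
    have iS : Integrable (fun ω => (YT ω : ℝ) + (YSc ω : ℝ)) ℙ := iT.add iSc
    rw [integral_sub (iS.const_mul _) iT, integral_const_mul, integral_add iT iSc,
      eT, eSc]
    field_simp
    ring
  have hdecomp (p : ℝ) : lT - lT ^ 2 / lS
      = variance (fun ω => p * ((YT ω : ℝ) + (YSc ω : ℝ)) - (YT ω : ℝ)) ℙ
        - lS * (p - lT / lS) ^ 2 := by
    rw [hvar]
    field_simp
    ring
  have hle (p : ℝ) : lT - lT ^ 2 / lS
      ≤ variance (fun ω => p * ((YT ω : ℝ) + (YSc ω : ℝ)) - (YT ω : ℝ)) ℙ := by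
    rw [hdecomp p]
    exact sub_le_self _ (by positivity)
  refine ⟨hmean, ?_, hdecomp _, hdecomp _, hle _, hle _⟩
  rw [← variance_of_integral_eq_zero (by fun_prop) hmean,
    hdecomp (lT / lS)]
  simp
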